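/- Let R = ∏_{i=1}^t ∏_{j=1}^{n_i} R_{i,j}, where each R_{i,j} is a finite commutative local Frobenius ring with residue field of order q_i, and q_1, …, q_t are distinct prime powers; set soc(R) := {a : a_{i,j} ∈ soc(R_{i,j}) for all i,j} and wt(a_i) := #{j : a_{i,j} ≠ 0}. Assume the list [(q_1,n_1), …, (q_t,n_t)] is separating, and let ω be a normalized homogeneous weight on R. Then for all a, b ∈ R: ω(a) = ω(b) if and only if either both a, b ∉ soc(R), or both a, b ∈ soc(R) and wt(a_i) = wt(b_i) for all i = 1, …, t. (That is, the partition of R induced by the homogeneous weight coincides with the partition H' whose blocks are R \ soc(R) and the sets {a ∈ soc(R) : wt(a_i) = m_i for all i}.) -/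

import Mathlib

/-- `ω : R → ℝ` is a normalized homogeneous weight on the finite ring `R`. -/
def IsNormHomWeight (R : Type*) [Ring R] [Fintype R] [DecidableEq R] (ω : R → ℝ) : Prop :=
  ω 0 = 0 ∧
  (∀ x y : R, Finset.image (fun r => r * x) Finset.univ
      = Finset.image (fun r => r * y) Finset.univ → ω x = ω y) ∧
  ∀ x : R, x ≠ 0 →
    ∑ y ∈ Finset.image (fun r => r * x) Finset.univ, ω y
      = ((Finset.image (fun r => r * x) Finset.univ).card : ℝ)

/-- The list `[(q 1, n 1), …, (q t, n t)]` is separating: for all tuples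
`m ≠ ℓ` in `{0,…,n 1} × ⋯ × {0,…,n t}`, either `∏ (q i − 1)^{m i} ≠ ∏ (q i − 1)^{ℓ i}` or
`Σ m i ≢ Σ ℓ i (mod 2)`. -/
def SeparatingList {t : ℕ} (q n : Fin t → ℕ) : Prop :=
  ∀ m ℓ : Fin t → ℕ, (∀ i, m i ≤ n i) → (∀ i, ℓ i ≤ n i) → m ≠ ℓ →
    (∏ i, (q i - 1) ^ m i ≠ ∏ i, (q i - 1) ^ ℓ i) ∨ (∑ i, m i) % 2 ≠ (∑ i, ℓ i) % 2

open Finset in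
/-- A finite ring carries at most one normalized homogeneous weight. -/
theorem IsNormHomWeight.unique {R : Type*} [Ring R] [Fintype R] [DecidableEq R] {ω₁ ω₂ : R → ℝ}
    (h₁ : IsNormHomWeight R ω₁) (h₂ : IsNormHomWeight R ω₂) : ω₁ = ω₂ := by
  suffices H : ∀ (k : ℕ) (x : R), (image (fun r => r * x) univ).card = k → ω₁ x = ω₂ x from
    funext fun x => H _ x rfl
  intro k
  induction k using Nat.strong_induction_on with
  | _ k ih =>
    intro x hk
    by_cases hx : x = 0
    · rw [hx, h₁.1, h₂.1]
    have hmem : x ∈ image (fun r => r * x) univ := mem_image.2 ⟨1, mem_univ _, one_mul x⟩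
    have hsum : ∑ y ∈ image (fun r => r * x) univ, (ω₁ y - ω₂ y) = 0 := by
      rw [sum_sub_distrib, h₁.2.2 x hx, h₂.2.2 x hx, sub_self]
    have hterm : ∀ y ∈ image (fun r => r * x) univ, ω₁ y - ω₂ y =
        if image (fun r => r * y) univ = image (fun r => r * x) univ
          then ω₁ x - ω₂ x else 0 := by
      intro y hy
      split_ifs with h
      · rw [h₁.2.1 y x h, h₂.2.1 y x h]
      · have hsub : image (fun r => r * y) univ ⊆ image (fun r => r * x) univ := by
          obtain ⟨s, -, rfl⟩ := mem_image.1 hy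
          intro z hz
          obtain ⟨r, -, rfl⟩ := mem_image.1 hz
          exact mem_image.2 ⟨r * s, mem_univ _, mul_assoc r s x⟩
        rw [ih _ (hk ▸ card_lt_card (hsub.ssubset_of_ne h)) y rfl, sub_self]
    rw [sum_congr rfl hterm, ← sum_filter, sum_const, nsmul_eq_mul] at hsum
    have hcard : ((filter (fun y => image (fun r => r * y) univ = image (fun r => r * x) univ)
        (image (fun r => r * x) univ)).card : ℝ) ≠ 0 := by
      exact Nat.cast_ne_zero.2 (card_ne_zero_of_mem (mem_filter.2 ⟨hmem, rfl⟩))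
    exact sub_eq_zero.1 ((mul_eq_zero.1 hsum).resolve_left hcard)

/-- Over a principal left ideal of a finite product of rings, a sum of products factors. -/
theorem sum_image_mul_pi_prod {ι : Type*} [Fintype ι] [DecidableEq ι] {A : ι → Type*}
    [∀ i, Ring (A i)] [∀ i, Fintype (A i)] [∀ i, DecidableEq (A i)]
    (f : ∀ i, A i → ℝ) (x : ∀ i, A i) :
    ∑ y ∈ Finset.image (fun r => r * x) Finset.univ, ∏ i, f i (y i)
      = ∏ i, ∑ y ∈ Finset.image (fun r => r * x i) Finset.univ, f i y := by
  rw [Finset.prod_univ_sum]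
  refine Finset.sum_congr ?_ fun _ _ => rfl
  ext y
  simp only [Finset.mem_image, Finset.mem_univ, true_and, Fintype.mem_piFinset]
  constructor
  · rintro ⟨r, rfl⟩ i
    exact ⟨r i, rfl⟩
  · intro h
    choose r hr using h
    exact ⟨r, funext hr⟩

section LocalFrobenius

open IsLocalRing

/-- In an Artinian local ring every nonzero element has a nonzero multiple in the socle. -/
theorem exists_mul_mem_socle {A : Type*} [CommRing A] [IsLocalRing A] [IsArtinianRing A]
    (x : A) (hx : x ≠ 0) : ∃ r : A, r * x ≠ 0 ∧ ∀ z ∈ maximalIdeal A, r * x * z = 0 := by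
  suffices H : ∀ (I : Ideal A) (x : A), Ideal.span {x} = I → x ≠ 0 →
      ∃ r : A, r * x ≠ 0 ∧ ∀ z ∈ maximalIdeal A, r * x * z = 0 from H _ x rfl hx
  intro I
  induction I using WellFoundedLT.induction with
  | _ I ih =>
    rintro x rfl hx
    by_cases h : ∀ z ∈ maximalIdeal A, x * z = 0
    · exact ⟨1, by simpa using hx, by simpa using h⟩
    push Not at h
    obtain ⟨z, hz, hxz⟩ := h
    have hlt : Ideal.span {x * z} < Ideal.span {x} := by
      refine lt_of_le_of_ne (Ideal.span_singleton_le_span_singleton.2 ⟨z, rfl⟩) fun he => ?_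
      obtain ⟨r, hr⟩ := Ideal.span_singleton_le_span_singleton.1 he.ge
      have hu : IsUnit (1 - z * r) := isUnit_one_sub_self_of_mem_nonunits _
        ((mem_maximalIdeal _).1 (Ideal.mul_mem_right r _ hz))
      exact hx ((hu.mul_left_eq_zero).1 (by linear_combination hr))
    obtain ⟨r, hr, hr'⟩ := ih _ hlt (x * z) rfl hxz
    refine ⟨r * z, ?_, ?_⟩
    · rwa [show r * z * x = r * (x * z) by ring]
    · rwa [show r * z * x = r * (x * z) by ring]

/-- If the socle of a finite local ring is as large as the residue field, then it is contained in
every nonzero principal ideal. -/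
theorem exists_mul_eq_of_mem_socle {A : Type*} [CommRing A] [IsLocalRing A] [Finite A]
    (hcard : Nat.card {b : A // ∀ x ∈ maximalIdeal A, b * x = 0} =
      Nat.card (A ⧸ maximalIdeal A))
    (x : A) (hx : x ≠ 0) (b : A) (hb : ∀ z ∈ maximalIdeal A, b * z = 0) :
    ∃ r : A, r * x = b := by
  obtain ⟨s, hs, hs'⟩ := exists_mul_mem_socle x hx
  have hker : LinearMap.ker (LinearMap.toSpanSingleton A A (s * x)) = maximalIdeal A := by
    ext a
    rw [LinearMap.mem_ker, LinearMap.toSpanSingleton_apply, smul_eq_mul]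
    refine ⟨fun h => (mem_maximalIdeal a).2 fun hu => hs ((hu.mul_right_eq_zero).1 h), fun h => ?_⟩
    rw [mul_comm, hs' a h]
  have hsub : (LinearMap.range (LinearMap.toSpanSingleton A A (s * x)) : Set A) ⊆
      {b : A | ∀ x ∈ maximalIdeal A, b * x = 0} := by
    rintro _ ⟨a, rfl⟩ z hz
    rw [LinearMap.toSpanSingleton_apply, smul_eq_mul, mul_assoc, hs' z hz, mul_zero]
  have hrange : Nat.card (LinearMap.range (LinearMap.toSpanSingleton A A (s * x))) =
      Nat.card (A ⧸ maximalIdeal A) := by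
    rw [← Nat.card_congr (LinearMap.quotKerEquivRange _).toEquiv, hker]
  have heq := Set.eq_of_subset_of_ncard_le hsub
    (show Nat.card {b : A // ∀ x ∈ maximalIdeal A, b * x = 0} ≤
      Nat.card (LinearMap.range (LinearMap.toSpanSingleton A A (s * x))) by rw [hcard, hrange])
  obtain ⟨a, ha⟩ : b ∈ (LinearMap.range (LinearMap.toSpanSingleton A A (s * x)) : Set A) :=
    heq ▸ hb
  exact ⟨a * s, by rw [← ha, LinearMap.toSpanSingleton_apply, smul_eq_mul, mul_assoc]⟩

open Classical in
/-- The function on a local ring that is `1` at `0`, `-1 / (q - 1)` on the nonzero elements of the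
socle and `0` elsewhere. -/
noncomputable def socleFactor (A : Type*) [CommRing A] [IsLocalRing A] (q : ℕ) (y : A) : ℝ :=
  if ∀ z ∈ maximalIdeal A, y * z = 0 then
    if y = 0 then 1 else (-((q - 1 : ℕ) : ℝ))⁻¹
  else 0

theorem socleFactor_zero {A : Type*} [CommRing A] [IsLocalRing A] (q : ℕ) :
    socleFactor A q 0 = 1 := by
  simp [socleFactor]

theorem socleFactor_eq_of_dvd_dvd {A : Type*} [CommRing A] [IsLocalRing A] (q : ℕ) {x y : A}
    (hxy : x ∣ y) (hyx : y ∣ x) : socleFactor A q x = socleFactor A q y := by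
  obtain ⟨r, hr⟩ := hxy
  obtain ⟨s, hs⟩ := hyx
  have hsoc : (∀ z ∈ maximalIdeal A, x * z = 0) ↔ ∀ z ∈ maximalIdeal A, y * z = 0 := by
    constructor <;> intro h z hz
    · rw [hr, mul_right_comm, h z hz, zero_mul]
    · rw [hs, mul_right_comm, h z hz, zero_mul]
  have hzero : x = 0 ↔ y = 0 :=
    ⟨fun h => by rw [hr, h, zero_mul], fun h => by rw [hs, h, zero_mul]⟩
  unfold socleFactor
  congr 1
  · exact propext hsoc
  · rw [hzero]

theorem sum_socleFactor_eq_zero {A : Type*} [CommRing A] [IsLocalRing A] [Fintype A]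
    [DecidableEq A] {q : ℕ} (hq2 : 2 ≤ q)
    (hq : Nat.card (A ⧸ maximalIdeal A) = q)
    (hsoc : Nat.card {b : A // ∀ x ∈ maximalIdeal A, b * x = 0} = q)
    (x : A) (hx : x ≠ 0) :
    ∑ y ∈ Finset.image (fun r => r * x) Finset.univ, socleFactor A q y = 0 := by
  classical
  have hfilter : (Finset.image (fun r => r * x) Finset.univ).filter
      (fun y => ∀ z ∈ maximalIdeal A, y * z = 0) =
      Finset.univ.filter (fun y => ∀ z ∈ maximalIdeal A, y * z = 0) := by
    ext b
    simp only [Finset.mem_filter, Finset.mem_image, Finset.mem_univ, true_and,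
      and_iff_right_iff_imp]
    exact exists_mul_eq_of_mem_socle (hsoc.trans hq.symm) x hx b
  have hcard : (Finset.univ.filter (fun y : A => ∀ z ∈ maximalIdeal A, y * z = 0)).card = q := by
    rw [← hsoc, Nat.card_eq_fintype_card, Fintype.card_subtype]
  have hmem : (0 : A) ∈ Finset.univ.filter (fun y : A => ∀ z ∈ maximalIdeal A, y * z = 0) := by
    simp
  have hne : ((q - 1 : ℕ) : ℝ) ≠ 0 := by
    exact_mod_cast (by omega : q - 1 ≠ 0)
  have hsum : ∑ y ∈ Finset.image (fun r => r * x) Finset.univ, socleFactor A q y =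
      ∑ y ∈ (Finset.image (fun r => r * x) Finset.univ).filter
        (fun y => ∀ z ∈ maximalIdeal A, y * z = 0),
        if y = 0 then 1 else (-((q - 1 : ℕ) : ℝ))⁻¹ := by
    rw [Finset.sum_filter]
    refine Finset.sum_congr rfl fun y _ => ?_
    unfold socleFactor
    congr
  rw [hsum, hfilter, ← Finset.add_sum_erase _ _ hmem, if_pos rfl,
    Finset.sum_congr rfl fun y hy => if_neg (Finset.ne_of_mem_erase hy), Finset.sum_const,
    Finset.card_erase_of_mem hmem, hcard, nsmul_eq_mul, inv_neg, mul_neg, mul_inv_cancel₀ hne]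
  norm_num

end LocalFrobenius

section Product

variable {t : ℕ} {n : Fin t → ℕ} (R : (i : Fin t) → Fin (n i) → Type*)
  [∀ i j, CommRing (R i j)] [∀ i j, IsLocalRing (R i j)]

theorem isNormHomWeight_one_sub_prod_socleFactor
    [∀ i j, Fintype (R i j)] [∀ i j, DecidableEq (R i j)]
    {q : Fin t → ℕ} (hq2 : ∀ i, 2 ≤ q i)
    (hq : ∀ i j, Nat.card (R i j ⧸ IsLocalRing.maximalIdeal (R i j)) = q i)
    (hsoc : ∀ i j,
      Nat.card {b : R i j // ∀ x ∈ IsLocalRing.maximalIdeal (R i j), b * x = 0} = q i) :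
    IsNormHomWeight (∀ i, ∀ j, R i j)
      (fun a => 1 - ∏ i, ∏ j, socleFactor (R i j) (q i) (a i j)) := by
  refine ⟨by simp [socleFactor_zero], fun x y hxy => ?_, fun x hx => ?_⟩
  · have hx : x ∈ Finset.image (fun r => r * y) Finset.univ :=
      hxy ▸ Finset.mem_image.2 ⟨1, Finset.mem_univ _, one_mul x⟩
    have hy : y ∈ Finset.image (fun r => r * x) Finset.univ :=
      hxy ▸ Finset.mem_image.2 ⟨1, Finset.mem_univ _, one_mul y⟩
    obtain ⟨r, -, hr⟩ := Finset.mem_image.1 hx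
    obtain ⟨s, -, hs⟩ := Finset.mem_image.1 hy
    refine congrArg (1 - ·) (Finset.prod_congr rfl fun i _ => Finset.prod_congr rfl fun j _ => ?_)
    exact socleFactor_eq_of_dvd_dvd (q i)
      (Dvd.intro_left (s i j) (congrFun (congrFun hs i) j))
      (Dvd.intro_left (r i j) (congrFun (congrFun hr i) j))
  · obtain ⟨i, hi⟩ := Function.ne_iff.1 hx
    obtain ⟨j, hj⟩ := Function.ne_iff.1 hi
    rw [Finset.sum_sub_distrib, Finset.sum_const, nsmul_eq_mul, mul_one,
      sum_image_mul_pi_prod (fun i (y : ∀ j, R i j) => ∏ j, socleFactor (R i j) (q i) (y j)) x,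
      Finset.prod_eq_zero (Finset.mem_univ i), sub_zero]
    rw [sum_image_mul_pi_prod (fun j (y : R i j) => socleFactor (R i j) (q i) y) (x i)]
    exact Finset.prod_eq_zero (Finset.mem_univ j)
      (sum_socleFactor_eq_zero (hq2 i) (hq i j) (hsoc i j) _ hj)

variable {R}

theorem prod_socleFactor_of_notMem_socle (q : Fin t → ℕ) {a : ∀ i, ∀ j, R i j}
    (ha : ¬ ∀ i j, ∀ x ∈ IsLocalRing.maximalIdeal (R i j), a i j * x = 0) :
    ∏ i, ∏ j, socleFactor (R i j) (q i) (a i j) = 0 := by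
  rw [not_forall] at ha
  obtain ⟨i, hi⟩ := ha
  rw [not_forall] at hi
  obtain ⟨j, hj⟩ := hi
  exact Finset.prod_eq_zero (Finset.mem_univ i)
    (Finset.prod_eq_zero (Finset.mem_univ j) (if_neg hj))

theorem prod_socleFactor_of_mem_socle [∀ i j, DecidableEq (R i j)] (q : Fin t → ℕ)
    {a : ∀ i, ∀ j, R i j}
    (ha : ∀ i j, ∀ x ∈ IsLocalRing.maximalIdeal (R i j), a i j * x = 0) :
    ∏ i, ∏ j, socleFactor (R i j) (q i) (a i j) =
      (∏ i, (-((q i - 1 : ℕ) : ℝ)) ^ (Finset.univ.filter (fun j => a i j ≠ 0)).card)⁻¹ := by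
  rw [← Finset.prod_inv_distrib]
  refine Finset.prod_congr rfl fun i _ => ?_
  rw [← inv_pow, ← Finset.prod_const, Finset.prod_filter]
  refine Finset.prod_congr rfl fun j _ => ?_
  rw [socleFactor, if_pos (ha i j)]
  by_cases h : a i j = 0 <;> simp [h]

end Product

theorem prod_neg_natCast_pow {t : ℕ} (c m : Fin t → ℕ) :
    ∏ i, (-(c i : ℝ)) ^ m i = (-1) ^ (∑ i, m i) * ((∏ i, c i ^ m i : ℕ) : ℝ) := by
  rw [← Finset.prod_pow_eq_pow_sum, Nat.cast_prod, ← Finset.prod_mul_distrib]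
  exact Finset.prod_congr rfl fun i _ => by rw [neg_pow, Nat.cast_pow]

theorem SeparatingList.eq_of_prod_eq {t : ℕ} {q n : Fin t → ℕ} (hsep : SeparatingList q n)
    (hq2 : ∀ i, 2 ≤ q i) {m l : Fin t → ℕ} (hm : ∀ i, m i ≤ n i) (hl : ∀ i, l i ≤ n i)
    (h : ∏ i, (-((q i - 1 : ℕ) : ℝ)) ^ m i = ∏ i, (-((q i - 1 : ℕ) : ℝ)) ^ l i) : m = l := by
  by_contra hne
  rw [prod_neg_natCast_pow, prod_neg_natCast_pow] at h
  have habs : ∏ i, (q i - 1) ^ m i = ∏ i, (q i - 1) ^ l i := by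
    have := congrArg abs h
    simp only [abs_mul, abs_pow, abs_neg, abs_one, one_pow, one_mul, Nat.abs_cast] at this
    exact_mod_cast this
  have hpos : ((∏ i, (q i - 1) ^ l i : ℕ) : ℝ) ≠ 0 := by
    have : ∏ i, (q i - 1) ^ l i ≠ 0 := Finset.prod_ne_zero_iff.2 fun i _ =>
      pow_ne_zero _ (by have := hq2 i; omega)
    exact_mod_cast this
  rw [habs] at h
  have hsign := mul_right_cancel₀ hpos h
  rcases hsep m l hm hl hne with h' | h'
  · exact h' habs
  · rw [neg_one_pow_eq_pow_mod_two, neg_one_pow_eq_pow_mod_two (∑ i, l i)] at hsign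
    rcases Nat.mod_two_eq_zero_or_one (∑ i, m i) with h1 | h1 <;>
      rcases Nat.mod_two_eq_zero_or_one (∑ i, l i) with h2 | h2 <;>
      rw [h1, h2] at hsign <;> first | omega | norm_num at hsign

/-- Let `R = ∏_{i,j} R_{i,j}` with `R_{i,j}` finite commutative local
Frobenius rings with residue fields of distinct prime power orders `q i`, and suppose
`[(q 1, n 1), …, (q t, n t)]` is separating.  Then for every normalized homogeneous weight
`ω` on `R` and all `a, b ∈ R`: `ω a = ω b` iff both `a, b ∉ soc(R)`, or both
`a, b ∈ soc(R)` with `wt(a_i) = wt(b_i)` for all `i`. -/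
theorem homWeight_partition_eq_hamming_of_separating {t : ℕ} {n : Fin t → ℕ}
    (R : (i : Fin t) → Fin (n i) → Type*)
    [∀ i j, CommRing (R i j)] [∀ i j, Fintype (R i j)] [∀ i j, DecidableEq (R i j)]
    [∀ i j, IsLocalRing (R i j)]
    (q : Fin t → ℕ) (hqpp : ∀ i, IsPrimePow (q i)) (hqdist : Function.Injective q)
    (hq : ∀ i j, Nat.card (R i j ⧸ IsLocalRing.maximalIdeal (R i j)) = q i)
    (hsoc : ∀ i j,
      Nat.card {b : R i j // ∀ x ∈ IsLocalRing.maximalIdeal (R i j), b * x = 0} = q i)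
    (hsep : SeparatingList q n)
    (ω : (∀ i, ∀ j, R i j) → ℝ) (hω : IsNormHomWeight (∀ i, ∀ j, R i j) ω) :
    ∀ a b : ∀ i, ∀ j, R i j,
      ω a = ω b ↔
        ((¬ ∀ i j, ∀ x ∈ IsLocalRing.maximalIdeal (R i j), a i j * x = 0) ∧
          (¬ ∀ i j, ∀ x ∈ IsLocalRing.maximalIdeal (R i j), b i j * x = 0)) ∨
        ((∀ i j, ∀ x ∈ IsLocalRing.maximalIdeal (R i j), a i j * x = 0) ∧
          (∀ i j, ∀ x ∈ IsLocalRing.maximalIdeal (R i j), b i j * x = 0) ∧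
          ∀ i, (Finset.univ.filter (fun j => a i j ≠ 0)).card
            = (Finset.univ.filter (fun j => b i j ≠ 0)).card) := by
  have hq2 : ∀ i, 2 ≤ q i := fun i => (hqpp i).two_le
  intro a b
  rw [hω.unique (isNormHomWeight_one_sub_prod_socleFactor R hq2 hq hsoc)]
  have hne : ∀ m : Fin t → ℕ, (∏ i, (-((q i - 1 : ℕ) : ℝ)) ^ m i)⁻¹ ≠ 0 := fun m =>
    inv_ne_zero (Finset.prod_ne_zero_iff.2 fun i _ => pow_ne_zero _ (neg_ne_zero.2 (by
      have := hq2 i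
      exact_mod_cast (by omega : q i - 1 ≠ 0))))
  rw [sub_right_inj]
  by_cases ha : ∀ i j, ∀ x ∈ IsLocalRing.maximalIdeal (R i j), a i j * x = 0 <;>
    by_cases hb : ∀ i j, ∀ x ∈ IsLocalRing.maximalIdeal (R i j), b i j * x = 0
  · rw [prod_socleFactor_of_mem_socle q ha, prod_socleFactor_of_mem_socle q hb, inv_inj]
    constructor
    · intro h
      exact Or.inr ⟨ha, hb, congrFun (hsep.eq_of_prod_eq hq2
        (fun i => (Finset.card_le_univ _).trans_eq (Fintype.card_fin _))
        (fun i => (Finset.card_le_univ _).trans_eq (Fintype.card_fin _)) h)⟩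
    · rintro (h | h)
      · exact absurd ha h.1
      · exact Finset.prod_congr rfl fun i _ => by rw [h.2.2 i]
  · rw [prod_socleFactor_of_mem_socle q ha, prod_socleFactor_of_notMem_socle q hb]
    exact iff_of_false (hne _) fun h => h.elim (fun h => h.1 ha) fun h => hb h.2.1
  · rw [prod_socleFactor_of_notMem_socle q ha, prod_socleFactor_of_mem_socle q hb]
    exact iff_of_false (hne _).symm fun h => h.elim (fun h => h.2 hb) fun h => ha h.1
  · rw [prod_socleFactor_of_notMem_socle q ha, prod_socleFactor_of_notMem_socle q hb]
    exact iff_of_true rfl (Or.inl ⟨ha, hb⟩)
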